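/- Let k be a field of characteristic zero containing a primitive r-th root of unity ζ, and let K = k(x,y) be a purely transcendental extension. Then the cyclic algebra (x,y)_ζ over K is a division algebra; in particular, its class in the Brauer group Br(K) has order exactly r. -/

import Mathlib

open scoped TensorProduct PiTensorProduct

/-- If `T` is a `σ`-semilinear operator on a finite-dimensional space whose `r`-th iterate is the
scalar `c`, then `c ^ dim` is a twisted norm. -/
theorem exists_prod_eq_pow_finrank_of_semilinear {L E : Type*} [Field L] [AddCommGroup E]
    [Module L E] [FiniteDimensional L E] (σ : L →+* L) (T : E →+ E)
    (hT : ∀ (l : L) (z : E), T (l • z) = σ l • T z) (r : ℕ) (c : L)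
    (hc : ∀ z, T^[r] z = c • z) :
    ∃ f : L, ∏ i ∈ Finset.range r, (σ ^ i) f = c ^ Module.finrank L E := by
  classical
  let b := Module.finBasis L E
  let F : Matrix (Fin (Module.finrank L E)) (Fin (Module.finrank L E)) L :=
    fun i j => b.repr (T (b j)) i
  have key : ∀ p : ℕ, ∃ G : Matrix (Fin (Module.finrank L E)) (Fin (Module.finrank L E)) L,
      (∀ j, T^[p] (b j) = ∑ i, G i j • b i) ∧
        G.det = ∏ i ∈ Finset.range p, (σ ^ i) F.det := by
    intro p
    induction p with
    | zero => exact ⟨1, by simp [Matrix.one_apply], by simp⟩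
    | succ p ih =>
      obtain ⟨G, hG, hdet⟩ := ih
      refine ⟨F * σ.mapMatrix G, fun j => ?_, ?_⟩
      · rw [Function.iterate_succ_apply', hG, map_sum]
        simp only [hT, Matrix.mul_apply, Finset.sum_smul]
        rw [Finset.sum_comm]
        refine Finset.sum_congr rfl fun i _ => ?_
        conv_lhs => rw [← b.sum_repr (T (b i)), Finset.smul_sum]
        refine Finset.sum_congr rfl fun l _ => ?_
        simp [F, smul_smul, mul_comm]
      · rw [Matrix.det_mul, ← RingHom.map_det, hdet, Finset.prod_range_succ', map_prod, mul_comm]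
        simp [pow_succ']
  obtain ⟨G, hG, hdet⟩ := key r
  refine ⟨F.det, ?_⟩
  have : G = Matrix.scalar _ c := by
    ext i j
    have h := congrArg (fun z => b.repr z i) ((hc (b j)).symm.trans (hG j))
    simp only [map_smul, map_sum, Finsupp.coe_smul, Pi.smul_apply, Module.Basis.repr_self,
      Finsupp.coe_finsetSum, Finset.sum_apply] at h
    simp only [Finsupp.single_apply, smul_eq_mul, mul_ite, mul_one, mul_zero,
      Finset.sum_ite_eq', Finset.mem_univ, if_true] at h
    simp [Matrix.diagonal_apply, ← h, eq_comm]
  rw [← hdet, this]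
  simp

section Tracial

variable {K B : Type*} [Field K] [Ring B] [Algebra K B]

/-- The averaging element `r⁻¹ ∑ g ^ l`, the projector onto the fixed part of an element `g` with
`g ^ r = 1`. -/
noncomputable def cyclicAverage (K : Type*) {B : Type*} [Field K] [Ring B] [Algebra K B]
    (r : ℕ) (g : B) : B :=
  (r : K)⁻¹ • ∑ l ∈ Finset.range r, g ^ l

theorem mul_cyclicAverage {r : ℕ} {g : B} (hg : g ^ r = 1) :
    g * cyclicAverage K r g = cyclicAverage K r g := by
  rw [cyclicAverage, mul_smul_comm]
  congr 1
  have h1 := Finset.sum_range_succ' (fun l => g ^ l) r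
  rw [Finset.sum_range_succ, hg, pow_zero, add_left_inj] at h1
  conv_rhs => rw [h1]
  simp [Finset.mul_sum, pow_succ']

theorem Commute.cyclicAverage {r : ℕ} {g c : B} (h : Commute g c) :
    Commute (cyclicAverage K r g) c := by
  refine Commute.smul_left (Commute.sum_left _ _ _ fun l _ => h.pow_left l) _

theorem cyclicAverage_mul_of_mul_eq [CharZero K] {r : ℕ} (hr : 0 < r) {g a : B} (h : g * a = a) :
    cyclicAverage K r g * a = a := by
  have h1 : ∀ l : ℕ, g ^ l * a = a := by
    intro l
    induction l with
    | zero => simp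
    | succ l ih => rw [pow_succ, mul_assoc, h, ih]
  have h2 : (r : K) ≠ 0 := by exact_mod_cast hr.ne'
  rw [cyclicAverage, smul_mul_assoc, Finset.sum_mul]
  simp only [h1, Finset.sum_const, Finset.card_range]
  rw [← Nat.cast_smul_eq_nsmul K, smul_smul, inv_mul_cancel₀ h2, one_smul]

theorem pow_mul_eq_smul_mul_pow {g v : B} {ζ : K} (h : g * v = ζ • (v * g)) (l : ℕ) :
    g ^ l * v = ζ ^ l • (v * g ^ l) := by
  induction l with
  | zero => simp
  | succ l ih =>
    rw [pow_succ, mul_assoc, h, mul_smul_comm, ← mul_assoc, ih, smul_mul_assoc, smul_smul,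
      mul_assoc, ← pow_succ']

theorem mul_pow_eq_smul_pow_mul {g v : B} {ζ : K} (h : g * v = ζ • (v * g)) (l : ℕ) :
    g * v ^ l = ζ ^ l • (v ^ l * g) := by
  induction l with
  | zero => simp
  | succ l ih =>
    rw [pow_succ, ← mul_assoc, ih, smul_mul_assoc, mul_assoc, h, mul_smul_comm, smul_smul, pow_succ,
      mul_assoc]

theorem eq_zero_of_mul_eq_smul_mul {τ : B →ₗ[K] K} (hτ : ∀ a b, τ (a * b) = τ (b * a)) {z v : B}
    {a : K} (hv : IsUnit v) (ha : a ≠ 1) (h : z * v = a • (v * z)) : τ z = 0 := by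
  obtain ⟨v, rfl⟩ := hv
  have h1 : τ z = a * τ z := by
    calc τ z = τ (z * v * (v⁻¹ : Bˣ)) := by rw [Units.mul_inv_cancel_right]
      _ = a * τ ((v * z) * (v⁻¹ : Bˣ)) := by rw [h, smul_mul_assoc, map_smul, smul_eq_mul]
      _ = a * τ z := by rw [hτ, Units.inv_mul_cancel_left]
  have h2 : (1 - a) * τ z = 0 := by linear_combination h1
  exact (mul_eq_zero.mp h2).resolve_left (sub_ne_zero.mpr ha.symm)

theorem trace_mul_cyclicAverage [CharZero K] {τ : B →ₗ[K] K}
    (hτ : ∀ a b, τ (a * b) = τ (b * a)) {r : ℕ} (hr : 0 < r) {ζ : K} (hζ : IsPrimitiveRoot ζ r)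
    {e g v : B} (hv : IsUnit v) (hgv : g * v = ζ • (v * g)) (hev : Commute e v) :
    r * τ (e * cyclicAverage K r g) = τ e := by
  have h2 : (r : K) ≠ 0 := by exact_mod_cast hr.ne'
  rw [cyclicAverage, mul_smul_comm, map_smul, smul_eq_mul, mul_inv_cancel_left₀ h2,
    Finset.mul_sum, map_sum, Finset.sum_eq_single_of_mem 0 (Finset.mem_range.mpr hr)]
  · simp
  · intro l hl hl0
    refine eq_zero_of_mul_eq_smul_mul hτ hv (a := ζ ^ l)
      (hζ.pow_ne_one_of_pos_of_lt hl0 (Finset.mem_range.mp hl)) ?_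
    rw [mul_assoc, pow_mul_eq_smul_mul_pow hgv, mul_smul_comm, ← mul_assoc, hev.eq, mul_assoc]

/-- A commuting family of elements `g i` with `g i ^ r = 1`, each of which `ζ`-commutes with a unit
commuting with the others, has a common fixed projector of trace `τ 1 / r ^ #S`. -/
theorem exists_idempotent_trace [CharZero K] {ι : Type*} [DecidableEq ι] {τ : B →ₗ[K] K}
    (hτ : ∀ a b, τ (a * b) = τ (b * a)) {r : ℕ} (hr : 0 < r) {ζ : K} (hζ : IsPrimitiveRoot ζ r)
    {g v : ι → B} (S : Finset ι) (hg : ∀ i ∈ S, g i ^ r = 1)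
    (hgg : ∀ i ∈ S, ∀ j ∈ S, Commute (g i) (g j)) (hv : ∀ i ∈ S, IsUnit (v i))
    (hgv : ∀ i ∈ S, g i * v i = ζ • (v i * g i))
    (hgv' : ∀ i ∈ S, ∀ j ∈ S, i ≠ j → Commute (g i) (v j)) :
    ∃ e : B, IsIdempotentElem e ∧ r ^ S.card * τ e = τ 1 ∧ (∀ i ∈ S, g i * e = e) ∧
      ∀ c, (∀ i ∈ S, Commute (g i) c) → Commute e c := by
  induction S using Finset.induction_on with
  | empty => exact ⟨1, IsIdempotentElem.one, by simp, by simp, fun c _ => Commute.one_left c⟩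
  | insert j S hj ih =>
    simp only [Finset.forall_mem_insert] at hg hgg hv hgv hgv'
    obtain ⟨e, he, hτe, hge, hce⟩ := ih hg.2 (fun i hi => (hgg.2 i hi).2) hv.2 hgv.2
      (fun i hi => (hgv'.2 i hi).2)
    have hej : Commute e (g j) := hce _ fun i hi => (hgg.2 i hi).1
    have hef : Commute e (cyclicAverage K r (g j)) := hej.symm.cyclicAverage.symm
    have hff : IsIdempotentElem (cyclicAverage K r (g j)) :=
      cyclicAverage_mul_of_mul_eq hr (mul_cyclicAverage hg.1)
    refine ⟨e * cyclicAverage K r (g j), he.mul_of_commute hef hff, ?_, ?_, ?_⟩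
    · rw [Finset.card_insert_of_notMem hj, pow_succ, mul_assoc,
        trace_mul_cyclicAverage hτ hr hζ hv.1 hgv.1, hτe]
      exact hce _ fun i hi => (hgv'.2 i hi).1 (fun h => hj (h ▸ hi))
    · simp only [Finset.forall_mem_insert]
      refine ⟨?_, fun i hi => by rw [← mul_assoc, hge i hi]⟩
      rw [hef.eq, ← mul_assoc, mul_cyclicAverage hg.1]
    · intro c hc
      simp only [Finset.forall_mem_insert] at hc
      exact (hce c hc.2).mul_left hc.1.cyclicAverage

/-- Units that are eigenvectors with pairwise distinct characters are linearly independent. -/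
theorem linearIndependent_of_distinct_characters {τ : B →ₗ[K] K}
    (hτ : ∀ a b, τ (a * b) = τ (b * a)) (hτ1 : τ 1 ≠ 0) {ι : Type*} {X : ι → B}
    (hX : ∀ p, IsUnit (X p))
    (h : ∀ p q, p ≠ q → ∃ (w : B) (α β : K), IsUnit w ∧ α ≠ β ∧
      w * X p = α • (X p * w) ∧ w * X q = β • (X q * w)) :
    LinearIndependent K X := by
  classical
  rw [linearIndependent_iff']
  intro s c hs q hq
  obtain ⟨Y, hY⟩ := hX q
  have key : ∀ p, p ≠ q → τ (X p * (Y⁻¹ : Bˣ)) = 0 := by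
    intro p hp
    obtain ⟨w, α, β, ⟨w, rfl⟩, hαβ, h1, h2⟩ := h p q hp
    rw [← hY] at h2
    have hnt : Nontrivial B := ⟨⟨1, 0, fun h => hτ1 (by rw [h, map_zero])⟩⟩
    have hβ : β ≠ 0 := by
      rintro rfl
      rw [zero_smul] at h2
      exact (w * Y).ne_zero h2
    have hα : α ≠ 0 := by
      rintro rfl
      obtain ⟨Z, hZ⟩ := hX p
      rw [zero_smul, ← hZ] at h1
      exact (w * Z).ne_zero h1
    have h3 : (Y⁻¹ : Bˣ) * (w : B) = β • ((w : B) * (Y⁻¹ : Bˣ)) := by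
      have := congrArg (fun z => (Y⁻¹ : Bˣ) * z * ((Y⁻¹ : Bˣ) : B)) h2
      simpa [mul_assoc] using this
    refine eq_zero_of_mul_eq_smul_mul hτ w.isUnit (a := α⁻¹ * β) ?_ ?_
    · rw [Ne, inv_mul_eq_one₀ hα]; exact hαβ
    · have h1' : X p * w = α⁻¹ • (w * X p) := by rw [h1, smul_smul, inv_mul_cancel₀ hα, one_smul]
      rw [mul_assoc, h3, mul_smul_comm, ← mul_assoc, h1', smul_mul_assoc, smul_smul, mul_comm β,
        mul_assoc]
  have h0 := congrArg (fun z => τ (z * (Y⁻¹ : Bˣ))) hs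
  simp only [Finset.sum_mul, map_sum, smul_mul_assoc, map_smul, zero_mul, map_zero,
    smul_eq_mul] at h0
  rw [Finset.sum_eq_single_of_mem q hq (fun p _ hp => by rw [key p hp, mul_zero]), ← hY,
    Units.mul_inv] at h0
  exact (mul_eq_zero.mp h0).resolve_right hτ1

end Tracial

theorem finrank_range_eq_trace {K V : Type*} [Field K] [AddCommGroup V] [Module K V]
    [FiniteDimensional K V] {e : Module.End K V} (he : IsIdempotentElem e) :
    (Module.finrank K (LinearMap.range e) : K) = LinearMap.trace K V e :=
  (LinearMap.IsIdempotentElem.isProj_range _ he).trace.symm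

/-- Operators `U`, `W` with `U W = ζ W U`, `U ^ r = t ^ r` and `W ^ r = c` force a power of `c` to
be a twisted norm from an extension `L` containing `t`, on which `σ` acts as a Kummer
automorphism. -/
theorem exists_finrank_eq_mul_and_prod_eq_pow {K L N : Type*} [Field K] [CharZero K] [Field L]
    [Algebra K L] [AddCommGroup N] [Module K N] [FiniteDimensional K N] {r : ℕ} (hr : 0 < r)
    {ζ : K} (hζ : IsPrimitiveRoot ζ r) (σ : L →ₐ[K] L) (hσr : σ ^ r = 1) {t : L} (ht : t ≠ 0)
    (hσ : ζ • σ t = t) {x c : K} (htx : t ^ r = algebraMap K L x) (hc : c ≠ 0)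
    {U W : Module.End K N} (hU : U ^ r = algebraMap K _ x) (hW : W ^ r = algebraMap K _ c)
    (hUW : U * W = ζ • (W * U)) :
    ∃ m : ℕ, Module.finrank K N = r * m ∧
      ∃ f : L, ∏ i ∈ Finset.range r, (σ ^ i) f = algebraMap K L c ^ m := by
  have : CharZero L := charZero_of_injective_algebraMap (algebraMap K L).injective
  let UL : Module.End L (L ⊗[K] N) := U.baseChange L
  let WL : Module.End L (L ⊗[K] N) := W.baseChange L
  let g : Module.End L (L ⊗[K] N) := t⁻¹ • UL
  have hUL : UL ^ r = algebraMap K L x • 1 := by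
    rw [← LinearMap.baseChange_pow, hU]
    ext z
    simp [Algebra.algebraMap_eq_smul_one, TensorProduct.smul_tmul']
  have hWL : WL ^ r = algebraMap K L c • 1 := by
    rw [← LinearMap.baseChange_pow, hW]
    ext z
    simp [Algebra.algebraMap_eq_smul_one, TensorProduct.smul_tmul']
  have hULWL : UL * WL = algebraMap K L ζ • (WL * UL) := by
    ext z
    have := LinearMap.congr_fun hUW z
    simp only [Module.End.mul_apply, LinearMap.smul_apply] at this
    simp [UL, WL, this]
  have hg : g ^ r = 1 := by
    rw [smul_pow, hUL, smul_smul, ← htx, ← mul_pow, inv_mul_cancel₀ ht, one_pow, one_smul]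
  have hcL : algebraMap K L c ≠ 0 := by simpa using hc
  have hWu : IsUnit WL := by
    refine (isUnit_pow_iff hr.ne').mp (hWL ▸ ?_)
    exact (IsUnit.mk0 _ hcL).map (algebraMap L (Module.End L (L ⊗[K] N)))
  let e := cyclicAverage L r g
  have he : IsIdempotentElem e := cyclicAverage_mul_of_mul_eq hr (mul_cyclicAverage hg)
  have htr := trace_mul_cyclicAverage (K := L) (τ := LinearMap.trace L (L ⊗[K] N))
    (LinearMap.trace_mul_comm L) hr (hζ.map_of_injective (algebraMap K L).injective) (e := 1)
    (g := g) hWu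
    (by rw [smul_mul_assoc, hULWL, mul_smul_comm, smul_comm]) (Commute.one_left _)
  rw [one_mul, ← finrank_range_eq_trace he, LinearMap.trace_one, Module.finrank_baseChange] at htr
  refine ⟨Module.finrank L (LinearMap.range e), by exact_mod_cast htr.symm, ?_⟩
  have hmem : ∀ z, z ∈ LinearMap.range e ↔ UL z = t • z := by
    intro z
    have h1 : UL z = t • z ↔ g z = z := by
      rw [LinearMap.smul_apply, inv_smul_eq_iff₀ ht]
    rw [h1]
    constructor
    · rintro ⟨y, rfl⟩
      exact LinearMap.congr_fun (mul_cyclicAverage (K := L) (B := Module.End L (L ⊗[K] N)) hg) y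
    · intro h
      refine ⟨z, ?_⟩
      have hrL : (r : L) ≠ 0 := by exact_mod_cast hr.ne'
      have hl : ∀ l : ℕ, (g ^ l) z = z := fun l => by
        rw [Module.End.pow_apply]; exact Function.iterate_fixed h l
      simp only [e, cyclicAverage, LinearMap.smul_apply, LinearMap.sum_apply, hl,
        Finset.sum_const, Finset.card_range]
      rw [← Nat.cast_smul_eq_nsmul L, smul_smul, inv_mul_cancel₀ hrL, one_smul]
  let T : (L ⊗[K] N) →ₗ[K] (L ⊗[K] N) := TensorProduct.map σ.toLinearMap W
  have hT : ∀ (l : L) z, T (l • z) = σ l • T z := by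
    intro l z
    induction z with
    | zero => simp
    | add y z hy hz => simp only [smul_add, map_add, hy, hz]
    | tmul a n => simp [T, TensorProduct.smul_tmul']
  have hUT : ∀ z, UL (T z) = ζ • T (UL z) := by
    intro z
    induction z with
    | zero => simp
    | add y z hy hz => simp only [smul_add, map_add, hy, hz]
    | tmul a n =>
      have := LinearMap.congr_fun hUW n
      simp only [Module.End.mul_apply, LinearMap.smul_apply] at this
      simp [T, UL, this]
  have hTr : ∀ z, T^[r] z = algebraMap K L c • z := by
    have h1 : T ^ r = TensorProduct.map ((σ.toLinearMap : Module.End K L) ^ r) (W ^ r) :=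
      TensorProduct.map_pow _ _ _
    have h2 : ∀ p : ℕ, (σ.toLinearMap : Module.End K L) ^ p = (σ ^ p).toLinearMap := by
      intro p
      induction p with
      | zero => rfl
      | succ p ih => rw [pow_succ, pow_succ, ih]; rfl
    intro z
    rw [← Module.End.pow_apply, h1, h2, hσr, hW]
    induction z with
    | zero => simp
    | add y z hy hz => simp only [smul_add, map_add, hy, hz]
    | tmul a n => simp [TensorProduct.smul_tmul', Algebra.smul_def]
  have hTE : ∀ z ∈ LinearMap.range e, T z ∈ LinearMap.range e := by
    intro z hz
    rw [hmem] at hz ⊢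
    rw [hUT, hz, hT, ← smul_assoc, hσ]
  let TE : LinearMap.range e →+ LinearMap.range e :=
    (T.toAddMonoidHom.comp (LinearMap.range e).subtype.toAddMonoidHom).codRestrict
      (LinearMap.range e) (fun z => hTE z z.2)
  have hTEr : ∀ (p : ℕ) z, ((TE^[p] z : LinearMap.range e) : L ⊗[K] N) = T^[p] z := by
    intro p
    induction p with
    | zero => simp
    | succ p ih => intro z; rw [Function.iterate_succ_apply, ih]; rfl
  obtain ⟨f, hf⟩ := exists_prod_eq_pow_finrank_of_semilinear (σ : L →+* L) TE
    (fun l z => Subtype.ext (hT l z)) r (algebraMap K L c)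
    (fun z => Subtype.ext (by rw [hTEr, hTr]; rfl))
  refine ⟨f, ?_⟩
  rw [← hf]
  refine Finset.prod_congr rfl fun i hi => ?_
  clear hi
  induction i with
  | zero => rfl
  | succ i ih => rw [pow_succ', pow_succ', AlgHom.mul_apply, ih]; rfl

/-- If a prime `y` is fixed by an automorphism, its exponent in a twisted norm of length `r` is
divisible by `r`. -/
theorem dvd_of_prod_eq_prime_pow {R L : Type*} [CommRing R] [IsDomain R] [WfDvdMonoid R] [Field L]
    [Algebra R L] [IsFractionRing R L] (s : R ≃+* R) (σ : L →+* L)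
    (hσ : ∀ p, σ (algebraMap R L p) = algebraMap R L (s p)) {y : R} (hy : Prime y) (hsy : s y = y)
    {r N : ℕ} (hr : 0 < r)
    {f : L} (hf : ∏ i ∈ Finset.range r, (σ ^ i) f = algebraMap R L y ^ N) : r ∣ N := by
  obtain ⟨p, q, hq, rfl⟩ := IsFractionRing.div_surjective (A := R) f
  have hq0 : q ≠ 0 := nonZeroDivisors.ne_zero hq
  have hσi : ∀ (i : ℕ) a, (σ ^ i) (algebraMap R L a) = algebraMap R L ((s ^ i) a) := by
    intro i
    induction i with
    | zero => intro a; rfl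
    | succ i ih =>
      intro a
      rw [pow_succ, pow_succ]
      change (σ ^ i) (σ _) = algebraMap R L ((s ^ i) (s a))
      rw [hσ, ih]
  have hsi : ∀ i : ℕ, (s ^ i) y = y := by
    intro i
    induction i with
    | zero => rfl
    | succ i ih =>
      rw [pow_succ]
      change (s ^ i) (s y) = y
      rw [hsy, ih]
  have hem : ∀ (i : ℕ) a, emultiplicity y ((s ^ i) a) = emultiplicity y a := by
    intro i a
    conv_lhs => rw [← hsi i]
    exact emultiplicity_map_eq (s ^ i)
  have hprod0 : ∏ i ∈ Finset.range r, (s ^ i) q ≠ 0 :=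
    Finset.prod_ne_zero_iff.mpr fun i _ => (map_ne_zero_iff _ (s ^ i).injective).mpr hq0
  have h1 : ∏ i ∈ Finset.range r, (s ^ i) p = y ^ N * ∏ i ∈ Finset.range r, (s ^ i) q := by
    apply IsFractionRing.injective R L
    simp only [map_div₀, hσi, Finset.prod_div_distrib] at hf
    rw [map_mul, map_prod, map_prod, map_pow, ← hf, div_mul_cancel₀]
    rwa [← map_prod, Ne, map_eq_zero_iff _ (IsFractionRing.injective R L)]
  have hp0 : p ≠ 0 := by
    rintro rfl
    have h2 : ∏ i ∈ Finset.range r, (s ^ i) (0 : R) = 0 :=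
      Finset.prod_eq_zero (Finset.mem_range.mpr hr) (map_zero _)
    exact mul_ne_zero (pow_ne_zero _ hy.ne_zero) hprod0 (h1.symm.trans h2)
  have h2 := congrArg (emultiplicity y) h1
  have hfp := FiniteMultiplicity.of_not_isUnit hy.not_isUnit hp0
  have hfq := FiniteMultiplicity.of_not_isUnit hy.not_isUnit hq0
  rw [emultiplicity_mul hy, Finset.emultiplicity_prod hy, Finset.emultiplicity_prod hy,
    emultiplicity_pow_self hy.ne_zero hy.not_isUnit] at h2
  simp only [hem, hfp.emultiplicity_eq_multiplicity, hfq.emultiplicity_eq_multiplicity,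
    Finset.sum_const, Finset.card_range, nsmul_eq_mul] at h2
  have h3 : r * multiplicity y p = N + r * multiplicity y q := by exact_mod_cast h2
  exact (Nat.dvd_add_left (dvd_mul_right r _)).mp (h3 ▸ dvd_mul_right r _)

section TwoVariables

variable {k : Type*} [Field k]

/-- The endomorphism `X₀ ↦ X₀ ^ r`, `X₁ ↦ X₁` of `k[X₀, X₁]`. -/
noncomputable def powFirstVariable (k : Type*) [Field k] (r : ℕ) :
    MvPolynomial (Fin 2) k →ₐ[k] MvPolynomial (Fin 2) k :=
  MvPolynomial.aeval ![MvPolynomial.X 0 ^ r, MvPolynomial.X 1]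

@[simp]
theorem powFirstVariable_X_zero (r : ℕ) :
    powFirstVariable k r (MvPolynomial.X 0) = MvPolynomial.X 0 ^ r := by
  simp [powFirstVariable]

@[simp]
theorem powFirstVariable_X_one (r : ℕ) :
    powFirstVariable k r (MvPolynomial.X 1) = MvPolynomial.X 1 := by
  simp [powFirstVariable]

theorem powFirstVariable_injective {r : ℕ} (hr : 0 < r) :
    Function.Injective (powFirstVariable k r) := by
  let ψ : MvPolynomial (Fin 2) k →ₐ[k] MvPolynomial (Fin 2) k :=
    MvPolynomial.aeval ![MvPolynomial.X 0, MvPolynomial.X 1 ^ r]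
  have h : ψ.comp (powFirstVariable k r) = MvPolynomial.expand r := by
    apply MvPolynomial.algHom_ext
    intro i
    fin_cases i <;> simp [ψ]
  have h2 := MvPolynomial.expand_injective (σ := Fin 2) (R := k) hr
  rw [← h, AlgHom.coe_comp] at h2
  exact Function.Injective.of_comp h2

/-- The endomorphism `X₀ ↦ a X₀`, `X₁ ↦ X₁` of `k[X₀, X₁]`. -/
noncomputable def scaleFirstVariable (a : k) :
    MvPolynomial (Fin 2) k →ₐ[k] MvPolynomial (Fin 2) k :=
  MvPolynomial.aeval ![MvPolynomial.C a * MvPolynomial.X 0, MvPolynomial.X 1]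

@[simp]
theorem scaleFirstVariable_X_zero (a : k) :
    scaleFirstVariable a (MvPolynomial.X 0) = MvPolynomial.C a * MvPolynomial.X 0 := by
  simp [scaleFirstVariable]

@[simp]
theorem scaleFirstVariable_X_one (a : k) :
    scaleFirstVariable a (MvPolynomial.X 1) = MvPolynomial.X 1 := by
  simp [scaleFirstVariable]

theorem scaleFirstVariable_mul (a b : k) :
    scaleFirstVariable (a * b) = scaleFirstVariable a * scaleFirstVariable b := by
  apply MvPolynomial.algHom_ext
  intro i
  have hC : scaleFirstVariable a (MvPolynomial.C b) = MvPolynomial.C b := by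
    rw [← MvPolynomial.algebraMap_eq, AlgHom.commutes]
  fin_cases i
  · simp [AlgHom.mul_apply, hC]
    ring
  · simp [AlgHom.mul_apply]

theorem scaleFirstVariable_one : scaleFirstVariable (1 : k) = 1 := by
  apply MvPolynomial.algHom_ext
  intro i
  fin_cases i <;> simp

theorem scaleFirstVariable_pow (a : k) (p : ℕ) :
    scaleFirstVariable (a ^ p) = scaleFirstVariable a ^ p := by
  induction p with
  | zero => rw [pow_zero, pow_zero, scaleFirstVariable_one]
  | succ p ih => rw [pow_succ, pow_succ, scaleFirstVariable_mul, ih]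

theorem scaleFirstVariable_comp_powFirstVariable {a : k} {r : ℕ} (ha : a ^ r = 1) :
    (scaleFirstVariable a).comp (powFirstVariable k r) = powFirstVariable k r := by
  apply MvPolynomial.algHom_ext
  intro i
  fin_cases i <;> simp [mul_pow, ← MvPolynomial.C_pow, ha]

/-- `scaleFirstVariable` as an automorphism. -/
noncomputable def scaleFirstVariableEquiv {a : k} (ha : a ≠ 0) :
    MvPolynomial (Fin 2) k ≃ₐ[k] MvPolynomial (Fin 2) k :=
  AlgEquiv.ofAlgHom (scaleFirstVariable a) (scaleFirstVariable a⁻¹)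
    ((scaleFirstVariable_mul a a⁻¹).symm.trans
      (by rw [mul_inv_cancel₀ ha, scaleFirstVariable_one]; rfl))
    ((scaleFirstVariable_mul a⁻¹ a).symm.trans
      (by rw [inv_mul_cancel₀ ha, scaleFirstVariable_one]; rfl))

end TwoVariables

/-- Over `K = k(x, y)`, operators with `U ^ r = x`, `W ^ r = y ^ n` and `U W = ζ W U` exist only on
spaces of dimension `d` with `r ^ 2 ∣ n d`. -/
theorem sq_dvd_mul_finrank_of_symbol_relations {k : Type*} [Field k] [CharZero k] {r : ℕ}
    (hr : 0 < r) {ζ : k} (hζ : IsPrimitiveRoot ζ r) {K : Type*} [Field K]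
    [Algebra (MvPolynomial (Fin 2) k) K] [IsFractionRing (MvPolynomial (Fin 2) k) K]
    {N : Type*} [AddCommGroup N] [Module K N] [FiniteDimensional K N] {U W : Module.End K N} {n : ℕ}
    (hU : U ^ r = algebraMap K _ (algebraMap (MvPolynomial (Fin 2) k) K (MvPolynomial.X 0)))
    (hW : W ^ r = algebraMap K _ (algebraMap (MvPolynomial (Fin 2) k) K (MvPolynomial.X 1) ^ n))
    (hUW : U * W = algebraMap (MvPolynomial (Fin 2) k) K (MvPolynomial.C ζ) • (W * U)) :
    r ^ 2 ∣ n * Module.finrank K N := by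
  let L := FractionRing (MvPolynomial (Fin 2) k)
  have hinjK : Function.Injective (algebraMap (MvPolynomial (Fin 2) k) K) :=
    IsFractionRing.injective (MvPolynomial (Fin 2) k) K
  have hinjL : Function.Injective (algebraMap (MvPolynomial (Fin 2) k) L) :=
    IsFractionRing.injective (MvPolynomial (Fin 2) k) L
  have hζ0 : ζ ≠ 0 := hζ.ne_zero hr.ne'
  have : CharZero K := charZero_of_injective_algebraMap hinjK
  let j : K →+* L := IsFractionRing.lift
    (g := (algebraMap (MvPolynomial (Fin 2) k) L).comp
      (powFirstVariable k r : MvPolynomial (Fin 2) k →+* MvPolynomial (Fin 2) k))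
    (hinjL.comp (powFirstVariable_injective hr))
  have hj : ∀ p, j (algebraMap (MvPolynomial (Fin 2) k) K p) =
      algebraMap (MvPolynomial (Fin 2) k) L (powFirstVariable k r p) := fun p =>
    IsFractionRing.lift_algebraMap _ p
  let s := scaleFirstVariableEquiv (inv_ne_zero hζ0)
  let σ₀ : L →+* L := IsFractionRing.lift
    (g := (algebraMap (MvPolynomial (Fin 2) k) L).comp
      (s : MvPolynomial (Fin 2) k →+* MvPolynomial (Fin 2) k))
    (hinjL.comp s.injective)
  have hσ₀ : ∀ p, σ₀ (algebraMap (MvPolynomial (Fin 2) k) L p) =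
      algebraMap (MvPolynomial (Fin 2) k) L (scaleFirstVariable ζ⁻¹ p) := fun p =>
    IsFractionRing.lift_algebraMap _ p
  have hζr : ζ⁻¹ ^ r = 1 := by rw [inv_pow, hζ.pow_eq_one, inv_one]
  let _ : Algebra K L := j.toAlgebra
  have hjj : ∀ a, algebraMap K L a = j a := fun _ => rfl
  have hσj : σ₀.comp j = j := by
    apply IsLocalization.ringHom_ext (nonZeroDivisors (MvPolynomial (Fin 2) k))
    refine RingHom.ext fun p => ?_
    have h := AlgHom.congr_fun (scaleFirstVariable_comp_powFirstVariable hζr) p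
    rw [AlgHom.comp_apply] at h
    simp only [RingHom.comp_apply, hj, hσ₀, h]
  let σ : L →ₐ[K] L := { σ₀ with commutes' := fun a => RingHom.congr_fun hσj a }
  have hσp : ∀ p, σ (algebraMap (MvPolynomial (Fin 2) k) L p) =
      algebraMap (MvPolynomial (Fin 2) k) L (scaleFirstVariable ζ⁻¹ p) := hσ₀
  have hσr : σ ^ r = 1 := by
    have h1 : ∀ (i : ℕ) p,
        (σ ^ i) (algebraMap (MvPolynomial (Fin 2) k) L p) =
          algebraMap (MvPolynomial (Fin 2) k) L ((scaleFirstVariable ζ⁻¹ ^ i) p) := by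
      intro i
      induction i with
      | zero => intro p; rfl
      | succ i ih =>
        intro p
        rw [pow_succ, pow_succ, AlgHom.mul_apply, AlgHom.mul_apply, hσp, ih]
    have h2 : ((σ ^ r : L →ₐ[K] L) : L →+* L) = RingHom.id L := by
      apply IsLocalization.ringHom_ext (nonZeroDivisors (MvPolynomial (Fin 2) k))
      refine RingHom.ext fun p => ?_
      change (σ ^ r) (algebraMap (MvPolynomial (Fin 2) k) L p) =
        algebraMap (MvPolynomial (Fin 2) k) L p
      rw [h1, ← scaleFirstVariable_pow, hζr, scaleFirstVariable_one]
      rfl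
    exact AlgHom.ext fun a => RingHom.congr_fun h2 a
  have hC : ∀ a : k, algebraMap K L (algebraMap (MvPolynomial (Fin 2) k) K (MvPolynomial.C a)) =
      algebraMap (MvPolynomial (Fin 2) k) L (MvPolynomial.C a) := by
    intro a
    rw [hjj, hj, ← MvPolynomial.algebraMap_eq, AlgHom.commutes]
  obtain ⟨m, hm, f, hf⟩ := exists_finrank_eq_mul_and_prod_eq_pow hr
    (hζ.map_of_injective (f := (algebraMap (MvPolynomial (Fin 2) k) K).comp MvPolynomial.C)
      (hinjK.comp (MvPolynomial.C_injective _ _))) σ hσr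
    (t := algebraMap (MvPolynomial (Fin 2) k) L (MvPolynomial.X 0))
    (by simp)
    (by
      rw [Algebra.smul_def, RingHom.comp_apply, hC, hσp, scaleFirstVariable_X_zero, ← map_mul,
        ← mul_assoc, ← MvPolynomial.C_mul, mul_inv_cancel₀ hζ0, MvPolynomial.C_1, one_mul])
    (by rw [hjj, hj, powFirstVariable_X_zero, map_pow])
    (pow_ne_zero n (by simp))
    hU hW hUW
  have hdvd : r ∣ n * m := by
    refine dvd_of_prod_eq_prime_pow (R := MvPolynomial (Fin 2) k) (L := L) s.toRingEquiv
      (σ : L →+* L) hσp (MvPolynomial.X_prime (i := 1)) (scaleFirstVariable_X_one _) hr (f := f) ?_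
    rw [map_pow, hjj, hj, powFirstVariable_X_one, ← pow_mul] at hf
    rw [← hf]
    refine Finset.prod_congr rfl fun i hi => ?_
    clear hi
    induction i with
    | zero => rfl
    | succ i ih => rw [pow_succ', pow_succ', AlgHom.mul_apply, ← ih]; rfl
  rw [hm, sq, mul_left_comm]
  exact mul_dvd_mul_left r hdvd

/-- An algebra of dimension `r ^ 2` over `k(x, y)` containing symbol generators for `(x, y)_ζ` is a
division algebra. -/
theorem isUnit_of_symbol_relations {k : Type*} [Field k] [CharZero k] {r : ℕ} (hr : 0 < r) {ζ : k}
    (hζ : IsPrimitiveRoot ζ r) {K : Type*} [Field K] [Algebra (MvPolynomial (Fin 2) k) K]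
    [IsFractionRing (MvPolynomial (Fin 2) k) K] {A : Type*} [Ring A] [Algebra K A]
    (hdim : Module.finrank K A = r ^ 2) {u v : A}
    (hu : u ^ r = algebraMap K A (algebraMap (MvPolynomial (Fin 2) k) K (MvPolynomial.X 0)))
    (hv : v ^ r = algebraMap K A (algebraMap (MvPolynomial (Fin 2) k) K (MvPolynomial.X 1)))
    (huv : u * v = algebraMap (MvPolynomial (Fin 2) k) K (MvPolynomial.C ζ) • (v * u))
    {a : A} (ha : a ≠ 0) : IsUnit a := by
  have hfd : FiniteDimensional K A :=
    FiniteDimensional.of_finrank_pos (hdim ▸ pow_pos hr 2)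
  have hleft : ∀ a : A, a ≠ 0 → ∃ b, b * a = 1 := by
    intro a ha
    let N : Submodule A A := Submodule.span A {a}
    have hfN : FiniteDimensional K N := inferInstanceAs (FiniteDimensional K (N.restrictScalars K))
    have hdvd := sq_dvd_mul_finrank_of_symbol_relations hr hζ (N := N) (n := 1)
      (U := Algebra.lsmul K K N u) (W := Algebra.lsmul K K N v)
      (by rw [← map_pow, hu, AlgHom.commutes])
      (by rw [← map_pow, hv, AlgHom.commutes, pow_one])
      (by rw [← map_mul, huv, map_smul, map_mul])
    rw [one_mul] at hdvd
    have hpos : 0 < Module.finrank K (N.restrictScalars K) := by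
      have : Nontrivial (N.restrictScalars K) :=
        ⟨⟨⟨a, Submodule.mem_span_singleton_self a⟩, 0, fun h => ha (congrArg Subtype.val h)⟩⟩
      exact Module.finrank_pos
    have htop : N.restrictScalars K = ⊤ :=
      Submodule.eq_top_of_finrank_eq
        ((Submodule.finrank_le _).antisymm (hdim ▸ Nat.le_of_dvd hpos hdvd))
    have h1 : (1 : A) ∈ N.restrictScalars K := htop ▸ Submodule.mem_top
    exact Submodule.mem_span_singleton.mp h1
  obtain ⟨b, hb⟩ := hleft a ha
  obtain ⟨c, hc⟩ := hleft b fun h => ha (by rw [← one_mul a, ← hb, h, zero_mul, zero_mul])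
  have hca : c = a := by rw [← mul_one c, ← hb, ← mul_assoc, hc, one_mul]
  exact ⟨⟨a, b, hca ▸ hc, hb⟩, rfl⟩

section CommutingSymbols

variable {K B ι : Type*} [Field K] [Ring B] [Algebra K B]

/-- A family of pairwise commuting pairs `(U i, V i)` of symbol generators, together with an element
`W` that `ζ`-commutes with each `U i`. -/
structure CommutingSymbols (r : ℕ) (ζ x : K) (U V : ι → B) (W : B) : Prop where
  pow_U : ∀ i, U i ^ r = algebraMap K B x
  isUnit_V : ∀ i, IsUnit (V i)
  U_mul_V : ∀ i, U i * V i = ζ • (V i * U i)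
  commute_U : ∀ i j, Commute (U i) (U j)
  commute_U_V : ∀ i j, i ≠ j → Commute (U i) (V j)
  U_mul_W : ∀ i, U i * W = ζ • (W * U i)
  commute_V_W : ∀ i, Commute (V i) W

variable {r : ℕ} {ζ x : K} {U V : ι → B} {W : B}

theorem CommutingSymbols.isUnit_U (h : CommutingSymbols r ζ x U V W) (hr : 0 < r) (hx : x ≠ 0)
    (i : ι) : IsUnit (U i) :=
  (isUnit_pow_iff hr.ne').mp (h.pow_U i ▸ (IsUnit.mk0 x hx).map (algebraMap K B))

/-- The element `U i / U o`, written without inverses using `U o ^ r = x`. -/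
noncomputable def symbolRatio (r : ℕ) (x : K) (U : ι → B) (o i : ι) : B :=
  x⁻¹ • (U i * U o ^ (r - 1))

namespace CommutingSymbols

theorem ratio_pow (h : CommutingSymbols r ζ x U V W) (hr : 0 < r) (hx : x ≠ 0) (o i : ι) :
    symbolRatio r x U o i ^ r = 1 := by
  rw [symbolRatio, smul_pow, ((h.commute_U i o).pow_right _).mul_pow, pow_right_comm, h.pow_U,
    h.pow_U, ← pow_succ', Nat.sub_add_cancel hr, ← map_pow, Algebra.algebraMap_eq_smul_one,
    smul_smul, ← mul_pow, inv_mul_cancel₀ hx, one_pow, one_smul]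

theorem commute_ratio_U (h : CommutingSymbols r ζ x U V W) (o i j : ι) :
    Commute (symbolRatio r x U o i) (U j) :=
  ((h.commute_U i j).mul_left ((h.commute_U o j).pow_left _)).smul_left _

theorem commute_ratio_ratio (h : CommutingSymbols r ζ x U V W) (o i j : ι) :
    Commute (symbolRatio r x U o i) (symbolRatio r x U o j) :=
  ((h.commute_ratio_U o i j).mul_right ((h.commute_ratio_U o i o).pow_right _)).smul_right _

theorem commute_ratio_V (h : CommutingSymbols r ζ x U V W) {o i j : ι} (hi : i ≠ j) (ho : o ≠ j) :
    Commute (symbolRatio r x U o i) (V j) :=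
  ((h.commute_U_V i j hi).mul_left ((h.commute_U_V o j ho).pow_left _)).smul_left _

theorem ratio_mul_V (h : CommutingSymbols r ζ x U V W) {o i : ι} (ho : o ≠ i) :
    symbolRatio r x U o i * V i = ζ • (V i * symbolRatio r x U o i) := by
  rw [symbolRatio, smul_mul_assoc, mul_assoc, ((h.commute_U_V o i ho).pow_left _).eq, ← mul_assoc,
    h.U_mul_V, smul_mul_assoc, mul_assoc, smul_comm, mul_smul_comm]

theorem commute_ratio_W (h : CommutingSymbols r ζ x U V W) (hr : 0 < r) (hζ : IsPrimitiveRoot ζ r)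
    (o i : ι) : Commute (symbolRatio r x U o i) W := by
  refine Commute.smul_left ?_ _
  rw [commute_iff_eq, mul_assoc, pow_mul_eq_smul_mul_pow (h.U_mul_W o), mul_smul_comm, ← mul_assoc,
    h.U_mul_W, smul_mul_assoc, smul_smul, ← pow_succ, Nat.sub_add_cancel hr, hζ.pow_eq_one,
    one_smul, mul_assoc]

theorem W_mul_U_pow (h : CommutingSymbols r ζ x U V W) (hr : 0 < r) (hζ : IsPrimitiveRoot ζ r)
    (o : ι) : W * U o ^ (r - 1) = ζ • (U o ^ (r - 1) * W) := by
  rw [pow_mul_eq_smul_mul_pow (h.U_mul_W o), smul_smul, ← pow_succ', Nat.sub_add_cancel hr,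
    hζ.pow_eq_one, one_smul]

theorem map (h : CommutingSymbols r ζ x U V W) {C : Type*} [Ring C] [Algebra K C]
    (φ : B →ₐ[K] C) :
    CommutingSymbols r ζ x (fun i => φ (U i)) (fun i => φ (V i)) (φ W) where
  pow_U i := by rw [← map_pow, h.pow_U, AlgHom.commutes]
  isUnit_V i := (h.isUnit_V i).map φ
  U_mul_V i := by rw [← map_mul, h.U_mul_V, map_smul, map_mul]
  commute_U i j := (h.commute_U i j).map φ
  commute_U_V i j hij := (h.commute_U_V i j hij).map φ
  U_mul_W i := by rw [← map_mul, h.U_mul_W, map_smul, map_mul]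
  commute_V_W i := (h.commute_V_W i).map φ

end CommutingSymbols

end CommutingSymbols

/-- If the symbols `(U i, V i)` act on a space of dimension `r ^ card ι` and `W ^ r = y ^ n`, then
`r ∣ n`: the joint fixed space of the `U i / U o` has dimension `r`. -/
theorem CommutingSymbols.dvd_of_finrank_eq_pow {k : Type*} [Field k] [CharZero k] {r : ℕ}
    (hr : 0 < r) {ζ : k} (hζ : IsPrimitiveRoot ζ r) {K : Type*} [Field K]
    [Algebra (MvPolynomial (Fin 2) k) K] [IsFractionRing (MvPolynomial (Fin 2) k) K]
    {ι : Type*} [Fintype ι] [DecidableEq ι]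
    {M : Type*} [AddCommGroup M] [Module K M] [FiniteDimensional K M]
    (hM : Module.finrank K M = r ^ Fintype.card ι) {U V : ι → Module.End K M} {W : Module.End K M}
    (h : CommutingSymbols r (algebraMap (MvPolynomial (Fin 2) k) K (MvPolynomial.C ζ))
      (algebraMap (MvPolynomial (Fin 2) k) K (MvPolynomial.X 0)) U V W)
    {n : ℕ}
    (hW : W ^ r = algebraMap K _ (algebraMap (MvPolynomial (Fin 2) k) K (MvPolynomial.X 1) ^ n))
    (o : ι) : r ∣ n := by
  have hinj : Function.Injective (algebraMap (MvPolynomial (Fin 2) k) K) :=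
    IsFractionRing.injective (MvPolynomial (Fin 2) k) K
  have : CharZero K := charZero_of_injective_algebraMap hinj
  have hζ' := hζ.map_of_injective (f := (algebraMap (MvPolynomial (Fin 2) k) K).comp MvPolynomial.C)
    (hinj.comp (MvPolynomial.C_injective _ _))
  set x := algebraMap (MvPolynomial (Fin 2) k) K (MvPolynomial.X 0) with hx
  have hx0 : x ≠ 0 := by simp [hx]
  obtain ⟨e, he, hτe, -, hce⟩ := exists_idempotent_trace (τ := LinearMap.trace K M)
    (LinearMap.trace_mul_comm K) hr hζ' (g := symbolRatio r x U o) (v := V) (Finset.univ.erase o)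
    (fun i _ => h.ratio_pow hr hx0 o i) (fun i _ j _ => h.commute_ratio_ratio o i j)
    (fun i _ => h.isUnit_V i) (fun i hi => h.ratio_mul_V (Finset.ne_of_mem_erase hi).symm)
    (fun i _ j hj hij => h.commute_ratio_V hij (Finset.ne_of_mem_erase hj).symm)
  have hdim : Module.finrank K (LinearMap.range e) = r := by
    rw [← finrank_range_eq_trace he, LinearMap.trace_one, hM,
      Finset.card_erase_of_mem (Finset.mem_univ o), Finset.card_univ] at hτe
    have hcard : r ^ Fintype.card ι = r ^ (Fintype.card ι - 1) * r := by
      rw [← pow_succ, Nat.sub_add_cancel (Fintype.card_pos_iff.mpr ⟨o⟩)]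
    rw [hcard] at hτe
    exact Nat.eq_of_mul_eq_mul_left (pow_pos hr _) (by exact_mod_cast hτe)
  have hstab : ∀ T : Module.End K M, Commute e T →
      ∀ z ∈ LinearMap.range e, T z ∈ LinearMap.range e := by
    rintro T hT _ ⟨z, rfl⟩
    exact ⟨T z, LinearMap.congr_fun hT.eq z⟩
  have hU := hstab (U o) (hce _ fun i _ => h.commute_ratio_U o i o)
  have hW' := hstab W (hce _ fun i _ => h.commute_ratio_W hr hζ' o i)
  have hdvd := sq_dvd_mul_finrank_of_symbol_relations hr hζ (n := n)
    (U := (U o).restrict hU) (W := W.restrict hW')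
    (by
      rw [Module.End.pow_restrict]
      ext z
      simp [h.pow_U, hx])
    (by
      rw [Module.End.pow_restrict]
      ext z
      change (W ^ r) z = _
      rw [hW]
      rfl)
    (by
      ext z
      exact LinearMap.congr_fun (h.U_mul_W o) z)
  rw [hdim, sq] at hdvd
  exact Nat.dvd_of_mul_dvd_mul_right hr hdvd

/-- An algebra of dimension `r ^ (2 card ι)` with symbols `(U i, V i)` splits if the element `W`
which `ζ`-commutes with all `U i` satisfies `W ^ r = c ^ r`. -/
theorem CommutingSymbols.nonempty_algEquiv_matrix {K B ι : Type*} [Field K] [CharZero K] [Ring B]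
    [Algebra K B] [Fintype ι] [DecidableEq ι] {r : ℕ} (hr : 0 < r) {ζ x c : K}
    (hζ : IsPrimitiveRoot ζ r) (hx : x ≠ 0) (hc : c ≠ 0) {U V : ι → B} {W : B}
    (h : CommutingSymbols r ζ x U V W) (hW : W ^ r = algebraMap K B (c ^ r))
    (hB : Module.finrank K B = (r ^ 2) ^ Fintype.card ι) (o : ι) {X : (ι → Fin r × Fin r) → B}
    (hX : ∀ p, IsUnit (X p)) (hUX : ∀ i p, U i * X p = ζ ^ ((p i).2 : ℕ) • (X p * U i))
    (hXV : ∀ i p, X p * V i = ζ ^ ((p i).1 : ℕ) • (V i * X p)) :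
    Nonempty (B ≃ₐ[K] Matrix (Fin (r ^ Fintype.card ι)) (Fin (r ^ Fintype.card ι)) K) := by
  have hfd : FiniteDimensional K B :=
    FiniteDimensional.of_finrank_pos (hB ▸ pow_pos (pow_pos hr 2) _)
  let τ : B →ₗ[K] K := LinearMap.trace K B ∘ₗ (LinearMap.mul K B).flip
  have hτ : ∀ a b, τ (a * b) = τ (b * a) := by
    intro a b
    have h1 : ∀ a b : B, τ (a * b) =
        LinearMap.trace K B (LinearMap.mulRight K b * LinearMap.mulRight K a) := fun a b =>
      congrArg (LinearMap.trace K B) (LinearMap.ext fun z => (mul_assoc z a b).symm)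
    rw [h1, h1, LinearMap.trace_mul_comm]
  have hτ1 : τ 1 = (r ^ 2) ^ Fintype.card ι := by
    have h1 : τ 1 = LinearMap.trace K B 1 :=
      congrArg (LinearMap.trace K B) (LinearMap.ext fun z => mul_one z)
    rw [h1, LinearMap.trace_one, hB]
    push_cast
    rfl
  let g : ι → B := fun i => if i = o then c⁻¹ • W else symbolRatio r x U o i
  let v : ι → B := fun i => if i = o then U o ^ (r - 1) else V i
  have hgo : g o = c⁻¹ • W := if_pos rfl
  have hvo : v o = U o ^ (r - 1) := if_pos rfl
  have hgi : ∀ i, i ≠ o → g i = symbolRatio r x U o i := fun i hi => if_neg hi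
  have hvi : ∀ i, i ≠ o → v i = V i := fun i hi => if_neg hi
  obtain ⟨e, he, hτe, -, -⟩ := exists_idempotent_trace hτ hr hζ (g := g) (v := v) Finset.univ
    (by
      intro i _
      by_cases hi : i = o
      · rw [hi, hgo, smul_pow, hW, Algebra.algebraMap_eq_smul_one, smul_smul, ← mul_pow,
          inv_mul_cancel₀ hc, one_pow, one_smul]
      · rw [hgi i hi, h.ratio_pow hr hx])
    (by
      intro i _ j _
      by_cases hi : i = o <;> by_cases hj : j = o
      · rw [hi, hj]
      · rw [hi, hgo, hgi j hj]
        exact (h.commute_ratio_W hr hζ o j).symm.smul_left _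
      · rw [hj, hgo, hgi i hi]
        exact (h.commute_ratio_W hr hζ o i).smul_right _
      · rw [hgi i hi, hgi j hj]
        exact h.commute_ratio_ratio o i j)
    (by
      intro i _
      by_cases hi : i = o
      · rw [hi, hvo]
        exact (h.isUnit_U hr hx o).pow _
      · rw [hvi i hi]
        exact h.isUnit_V i)
    (by
      intro i _
      by_cases hi : i = o
      · rw [hi, hvo, hgo, smul_mul_assoc, h.W_mul_U_pow hr hζ, mul_smul_comm, smul_comm]
      · rw [hgi i hi, hvi i hi, h.ratio_mul_V (Ne.symm hi)])
    (by
      intro i _ j _ hij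
      by_cases hi : i = o
      · rw [hi, hgo, hvi j (fun hj => hij (hi.trans hj.symm))]
        exact (h.commute_V_W j).symm.smul_left _
      · by_cases hj : j = o
        · rw [hgi i hi, hj, hvo]
          exact (h.commute_ratio_U o i o).pow_right _
        · rw [hgi i hi, hvi j hj]
          exact h.commute_ratio_V hij (Ne.symm hj))
  let N : Submodule B B := Submodule.span B {e}
  have hfN : FiniteDimensional K N := inferInstanceAs (FiniteDimensional K (N.restrictScalars K))
  have hN : Module.finrank K N = r ^ Fintype.card ι := by
    have h1 : N.restrictScalars K = LinearMap.range (LinearMap.mulRight K e) := by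
      ext z
      exact Submodule.mem_span_singleton
    have h2 : IsIdempotentElem (LinearMap.mulRight K e) := by
      ext z
      change z * e * e = z * e
      rw [mul_assoc, he.eq]
    have h3 := finrank_range_eq_trace h2
    rw [← h1] at h3
    have h4 : (Module.finrank K N : K) = τ e := h3
    rw [hτ1, ← h4, Finset.card_univ, ← pow_mul, mul_comm 2, pow_mul, sq] at hτe
    exact Nat.eq_of_mul_eq_mul_left (pow_pos hr (Fintype.card ι)) (by exact_mod_cast hτe)
  let ρ : B →ₐ[K] Module.End K N := Algebra.lsmul K K N
  have hζ0 : ζ ≠ 0 := hζ.ne_zero hr.ne'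
  have hζinj : ∀ a b : Fin r, a ≠ b → ζ ^ (a : ℕ) ≠ ζ ^ (b : ℕ) := fun a b hab hab' =>
    hab (Fin.ext (hζ.pow_inj a.2 b.2 hab'))
  have hli : LinearIndependent K fun p => ρ (X p) := by
    refine linearIndependent_of_distinct_characters (τ := LinearMap.trace K N)
      (LinearMap.trace_mul_comm K) ?_ (fun p => (hX p).map ρ) ?_
    · rw [LinearMap.trace_one, hN, Nat.cast_ne_zero]
      exact (pow_pos hr _).ne'
    · intro p q hpq
      obtain ⟨i, hi⟩ := Function.ne_iff.mp hpq
      by_cases h2 : (p i).2 = (q i).2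
      · have hVX : ∀ p, ρ (V i) * ρ (X p) = (ζ ^ ((p i).1 : ℕ))⁻¹ • (ρ (X p) * ρ (V i)) := by
          intro p
          rw [← map_mul, ← map_mul, hXV, map_smul, inv_smul_smul₀ (pow_ne_zero _ hζ0)]
        exact ⟨ρ (V i), _, _, (h.isUnit_V i).map ρ,
          fun h1 => hζinj _ _ (fun h1 => hi (Prod.ext h1 h2)) (inv_injective h1), hVX p, hVX q⟩
      · have hUX' : ∀ p, ρ (U i) * ρ (X p) = ζ ^ ((p i).2 : ℕ) • (ρ (X p) * ρ (U i)) := by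
          intro p
          rw [← map_mul, ← map_mul, hUX, map_smul]
        exact ⟨ρ (U i), _, _, (h.isUnit_U hr hx i).map ρ, hζinj _ _ h2, hUX' p, hUX' q⟩
  have hEnd : Module.finrank K (Module.End K N) = (r ^ 2) ^ Fintype.card ι := by
    rw [Module.finrank_linearMap, hN, ← mul_pow, sq]
  have hsurj : Function.Surjective ρ.toLinearMap := by
    rw [← LinearMap.range_eq_top, eq_top_iff,
      ← hli.span_eq_top_of_card_eq_finrank' (by rw [hEnd]; simp [sq]), Submodule.span_le]
    rintro _ ⟨p, rfl⟩
    exact ⟨X p, rfl⟩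
  have hinj : Function.Injective ρ.toLinearMap :=
    (LinearMap.injective_iff_surjective_of_finrank_eq_finrank (hB.trans hEnd.symm)).mpr hsurj
  exact ⟨(AlgEquiv.ofBijective ρ ⟨hinj, hsurj⟩).trans
    (algEquivMatrix (Module.finBasisOfFinrankEq K N hN))⟩

section PiTensorProduct

variable {K A ι : Type*} [Field K] [Ring A] [Algebra K A]

theorem finrank_piTensorProduct_const [Fintype ι] [FiniteDimensional K A] :
    Module.finrank K (⨂[K] _ : ι, A) = Module.finrank K A ^ Fintype.card ι := by
  classical
  rw [Module.finrank_eq_card_basis (Basis.piTensorProduct fun _ : ι => Module.finBasis K A)]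
  simp

theorem tprod_algebraMap_const [Fintype ι] (a : K) :
    PiTensorProduct.tprod K (fun _ : ι => algebraMap K A a) =
      algebraMap K (⨂[K] _ : ι, A) (a ^ Fintype.card ι) := by
  have h := (PiTensorProduct.tprod K).map_smul_univ (fun _ : ι => a) (1 : ι → A)
  rw [Finset.prod_const, Finset.card_univ] at h
  simp only [Algebra.algebraMap_eq_smul_one]
  exact h

theorem tprod_const_pow (a : A) (r : ℕ) :
    PiTensorProduct.tprod K (fun _ : ι => a) ^ r = PiTensorProduct.tprod K (fun _ : ι => a ^ r) :=
  (map_pow (PiTensorProduct.tprodMonoidHom K) (fun _ : ι => a) r).symm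

variable [DecidableEq ι]

theorem singleAlgHom_mul_tprod (i : ι) (a : A) (f : ι → A) :
    PiTensorProduct.singleAlgHom (R := K) (A := fun _ : ι => A) i a * PiTensorProduct.tprod K f =
      PiTensorProduct.tprod K (Function.update f i (a * f i)) := by
  rw [PiTensorProduct.singleAlgHom_apply, PiTensorProduct.tprod_mul_tprod]
  congr 1
  ext j
  by_cases hj : j = i
  · subst hj
    simp
  · simp [hj]

theorem tprod_mul_singleAlgHom (i : ι) (a : A) (f : ι → A) :
    PiTensorProduct.tprod K f * PiTensorProduct.singleAlgHom (R := K) (A := fun _ : ι => A) i a =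
      PiTensorProduct.tprod K (Function.update f i (f i * a)) := by
  rw [PiTensorProduct.singleAlgHom_apply, PiTensorProduct.tprod_mul_tprod]
  congr 1
  ext j
  by_cases hj : j = i
  · subst hj
    simp
  · simp [hj]

theorem singleAlgHom_mul_tprod_eq_smul {i : ι} {a : A} {f : ι → A} {z : K}
    (h : a * f i = z • (f i * a)) :
    PiTensorProduct.singleAlgHom (R := K) (A := fun _ : ι => A) i a * PiTensorProduct.tprod K f =
      z • (PiTensorProduct.tprod K f *
        PiTensorProduct.singleAlgHom (R := K) (A := fun _ : ι => A) i a) := by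
  rw [singleAlgHom_mul_tprod, tprod_mul_singleAlgHom, h, MultilinearMap.map_update_smul]

theorem tprod_mul_singleAlgHom_eq_smul {i : ι} {a : A} {f : ι → A} {z : K}
    (h : f i * a = z • (a * f i)) :
    PiTensorProduct.tprod K f * PiTensorProduct.singleAlgHom (R := K) (A := fun _ : ι => A) i a =
      z • (PiTensorProduct.singleAlgHom (R := K) (A := fun _ : ι => A) i a *
        PiTensorProduct.tprod K f) := by
  rw [singleAlgHom_mul_tprod, tprod_mul_singleAlgHom, h, MultilinearMap.map_update_smul]

theorem commute_singleAlgHom {i j : ι} (hij : i ≠ j) (a b : A) :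
    Commute (PiTensorProduct.singleAlgHom (R := K) (A := fun _ : ι => A) i a)
      (PiTensorProduct.singleAlgHom (R := K) (A := fun _ : ι => A) j b) := by
  simp only [PiTensorProduct.singleAlgHom_apply, MonoidHom.mulSingle_apply]
  exact (Pi.mulSingle_commute (f := fun _ : ι => A) hij a b).tprod

theorem CommutingSymbols.piTensorProduct {r : ℕ} {ζ x : K} {u v : A}
    (hu : u ^ r = algebraMap K A x) (hv : IsUnit v) (huv : u * v = ζ • (v * u)) :
    CommutingSymbols r ζ x
      (fun i : ι => PiTensorProduct.singleAlgHom (R := K) (A := fun _ : ι => A) i u)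
      (fun i : ι => PiTensorProduct.singleAlgHom (R := K) (A := fun _ : ι => A) i v)
      (PiTensorProduct.tprod K fun _ => v) where
  pow_U i := by rw [← map_pow, hu, AlgHom.commutes]
  isUnit_V i := hv.map _
  U_mul_V i := by rw [← map_mul, huv, map_smul, map_mul]
  commute_U i j := by
    by_cases hij : i = j
    · rw [hij]; exact Commute.refl _
    · exact commute_singleAlgHom hij u u
  commute_U_V i j hij := commute_singleAlgHom hij u v
  U_mul_W i := singleAlgHom_mul_tprod_eq_smul huv
  commute_V_W i := by
    rw [commute_iff_eq, singleAlgHom_mul_tprod, tprod_mul_singleAlgHom]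

end PiTensorProduct

/-!
STATEMENT 14: Let `k` be a field of characteristic zero containing a primitive
`r`-th root of unity `ζ`, and let `K = k(x,y)` be a purely transcendental
extension.  Then the cyclic algebra `(x,y)_ζ` over `K` is a division algebra;
in particular, its class in the Brauer group `Br(K)` has order exactly `r`.

The cyclic (symbol) algebra `(x,y)_ζ` is encoded as a central simple
`K`-algebra `A` of degree `r` (i.e. `dim_K A = r²`) generated by elements
`u, v` with `u^r = x`, `v^r = y`, `uv = ζ·vu`.  "Division algebra" is
expressed as: every nonzero element is a unit.  The order of the class of `A`
in `Br(K)` is expressed via the standard description of the Brauer group of a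
field: the class of the central simple algebra `A⊗ⁿ` is trivial if and only if
`A⊗ⁿ` is isomorphic to a matrix algebra over `K`; "order exactly `r`" says
this happens precisely when `r ∣ n`.
-/

theorem cyclic_algebra_division_and_order
    (k : Type) [Field k] [CharZero k]
    (r : ℕ) (hr : 2 ≤ r)
    (ζ : k) (hζ : IsPrimitiveRoot ζ r)
    -- K = k(x,y), a purely transcendental extension of k in two variables:
    (K : Type) [Field K] [Algebra (MvPolynomial (Fin 2) k) K]
    [IsFractionRing (MvPolynomial (Fin 2) k) K]
    (x y : K)
    (hx : x = algebraMap (MvPolynomial (Fin 2) k) K (MvPolynomial.X 0))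
    (hy : y = algebraMap (MvPolynomial (Fin 2) k) K (MvPolynomial.X 1))
    -- A = (x,y)_ζ, the cyclic algebra:
    (A : Type) [Ring A] [Algebra K A]
    [Algebra.IsCentral K A] [IsSimpleRing A]
    (hdim : Module.finrank K A = r ^ 2)
    (u v : A)
    (hgen : Algebra.adjoin K ({u, v} : Set A) = ⊤)
    (hu : u ^ r = algebraMap K A x)
    (hv : v ^ r = algebraMap K A y)
    (huv : u * v =
      algebraMap K A (algebraMap (MvPolynomial (Fin 2) k) K
        (MvPolynomial.C ζ)) * (v * u)) :
    (∀ a : A, a ≠ 0 → IsUnit a) ∧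
    (∀ n : ℕ, 0 < n →
      ((∃ s : ℕ, 0 < s ∧
          Nonempty ((⨂[K] _ : Fin n, A) ≃ₐ[K] Matrix (Fin s) (Fin s) K))
        ↔ r ∣ n)) := by
  subst hx hy
  have hr0 : 0 < r := by omega
  have hinj : Function.Injective (algebraMap (MvPolynomial (Fin 2) k) K) :=
    IsFractionRing.injective (MvPolynomial (Fin 2) k) K
  have : CharZero K := charZero_of_injective_algebraMap hinj
  have hζK : IsPrimitiveRoot (algebraMap (MvPolynomial (Fin 2) k) K (MvPolynomial.C ζ)) r :=
    hζ.map_of_injective (f := (algebraMap (MvPolynomial (Fin 2) k) K).comp MvPolynomial.C)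
      (hinj.comp (MvPolynomial.C_injective _ _))
  have hX : ∀ i, algebraMap (MvPolynomial (Fin 2) k) K (MvPolynomial.X i) ≠ 0 := fun i => by simp
  rw [← Algebra.smul_def] at huv
  have hfd : FiniteDimensional K A := FiniteDimensional.of_finrank_pos (hdim ▸ pow_pos hr0 2)
  have huu : IsUnit u :=
    (isUnit_pow_iff hr0.ne').mp (hu ▸ (IsUnit.mk0 _ (hX 0)).map (algebraMap K A))
  have hvu : IsUnit v :=
    (isUnit_pow_iff hr0.ne').mp (hv ▸ (IsUnit.mk0 _ (hX 1)).map (algebraMap K A))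
  refine ⟨fun a ha => isUnit_of_symbol_relations hr0 hζ hdim hu hv huv ha, fun n hn => ?_⟩
  have h := CommutingSymbols.piTensorProduct (ι := Fin n) hu hvu huv
  have hW : PiTensorProduct.tprod K (fun _ : Fin n => v) ^ r =
      algebraMap K _ (algebraMap (MvPolynomial (Fin 2) k) K (MvPolynomial.X 1) ^ n) := by
    rw [tprod_const_pow, hv, tprod_algebraMap_const, Fintype.card_fin]
  have hB : Module.finrank K (⨂[K] _ : Fin n, A) = (r ^ 2) ^ Fintype.card (Fin n) := by
    rw [finrank_piTensorProduct_const, hdim]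
  constructor
  · rintro ⟨s, -, ⟨φ⟩⟩
    have hs : s = r ^ Fintype.card (Fin n) := by
      have h1 := φ.toLinearEquiv.finrank_eq
      rw [hB, Module.finrank_matrix, Module.finrank_self, Fintype.card_fin s, mul_one, ← sq,
        pow_right_comm] at h1
      exact (Nat.pow_left_injective two_ne_zero h1).symm
    let ψ := (φ.trans Matrix.toLinAlgEquiv').toAlgHom
    refine (h.map ψ).dvd_of_finrank_eq_pow hr0 hζ ?_ ?_ ⟨0, hn⟩
    · rw [Module.finrank_fin_fun, hs]
    · rw [← map_pow, hW, AlgHom.commutes]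
  · rintro ⟨m, rfl⟩
    rw [pow_mul'] at hW
    refine ⟨_, pow_pos hr0 _, h.nonempty_algEquiv_matrix hr0 hζK (hX 0) (pow_ne_zero m (hX 1)) hW hB
      ⟨0, hn⟩ (X := fun p => PiTensorProduct.tprod K fun i => u ^ ((p i).1 : ℕ) * v ^ ((p i).2 : ℕ))
      (fun p => ?_) (fun i p => singleAlgHom_mul_tprod_eq_smul ?_)
      (fun i p => tprod_mul_singleAlgHom_eq_smul ?_)⟩
    · exact (Pi.isUnit_iff.mpr fun i => (huu.pow _).mul (hvu.pow _)).map
        (PiTensorProduct.tprodMonoidHom K)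
    · rw [← mul_assoc, ← pow_succ', pow_succ, mul_assoc, mul_pow_eq_smul_pow_mul huv,
        mul_smul_comm, mul_assoc]
    · rw [mul_assoc, ← pow_succ, pow_succ', ← mul_assoc, pow_mul_eq_smul_mul_pow huv,
        smul_mul_assoc, mul_assoc]
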